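/- Let d ∈ {3, 4} and let ε ∈ (0,1). Then there exists a constant C, depending only on d and ε, such that for all x ∈ ℝ^d with |x| ≥ 1, ( ∫_{{y : |x−y| ≥ 1 and |y| ≥ ε|x|}} |x − y|^{−2(d−2)} |y|^{−2(d−1)} dy )^{1/2} ≤ C |x|^{−(d−2)}. -/

import Mathlib

open MeasureTheory Real Filter
open scoped Real Topology

noncomputable section

/-- A product of powers of nonnegative reals is bounded by the sum of the total powers. -/
theorem pow_mul_pow_le_pow_add_pow {u v : ℝ} (hu : 0 ≤ u) (hv : 0 ≤ v) (p q : ℕ) :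
    u ^ p * v ^ q ≤ u ^ (p + q) + v ^ (p + q) := by
  rcases le_total u v with h | h
  · calc u ^ p * v ^ q ≤ v ^ p * v ^ q := by gcongr
      _ = v ^ (p + q) := (pow_add _ _ _).symm
      _ ≤ _ := le_add_of_nonneg_left (by positivity)
  · calc u ^ p * v ^ q ≤ u ^ p * u ^ q := by gcongr
      _ = u ^ (p + q) := (pow_add _ _ _).symm
      _ ≤ _ := le_add_of_nonneg_right (by positivity)

/-- Away from the origin, `t⁻¹` is comparable to `(1 + t)⁻¹`. -/
theorem inv_le_mul_inv_one_add {ε t : ℝ} (hε : 0 < ε) (ht : ε ≤ t) :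
    t⁻¹ ≤ (1 + ε⁻¹) * (1 + t)⁻¹ := by
  have ht0 : 0 < t := hε.trans_le ht
  rw [← div_eq_mul_inv, le_div_iff₀ (by positivity), mul_add, mul_one, inv_mul_cancel₀ ht0.ne',
    add_comm]
  gcongr

/-- If `a, b ≥ ε` and `b ≥ ε r`, two of the factors `b⁻¹` can be kept to make
`a ^ (-p) * b ^ (-2)` integrable, while the others give the decay `r ^ (-p)`. -/
theorem inv_pow_mul_inv_pow_le {ε r a b : ℝ} (hε : 0 < ε) (hr : 0 < r) (ha : ε ≤ a) (hb : ε ≤ b)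
    (hbr : ε * r ≤ b) (p : ℕ) :
    (a ^ p)⁻¹ * (b ^ (p + 2))⁻¹ ≤
      ((ε * r) ^ p)⁻¹ * (1 + ε⁻¹) ^ (p + 2) *
        (((1 + a)⁻¹) ^ (p + 2) + ((1 + b)⁻¹) ^ (p + 2)) := by
  have ha0 : 0 < a := hε.trans_le ha
  have hb0 : 0 < b := hε.trans_le hb
  calc (a ^ p)⁻¹ * (b ^ (p + 2))⁻¹ = (b ^ p)⁻¹ * (a⁻¹ ^ p * b⁻¹ ^ 2) := by
        rw [pow_add, inv_pow, inv_pow, mul_inv]; ring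
    _ ≤ ((ε * r) ^ p)⁻¹ * (a⁻¹ ^ (p + 2) + b⁻¹ ^ (p + 2)) := by
        gcongr
        exact pow_mul_pow_le_pow_add_pow (by positivity) (by positivity) p 2
    _ ≤ ((ε * r) ^ p)⁻¹ * (((1 + ε⁻¹) * (1 + a)⁻¹) ^ (p + 2) +
          ((1 + ε⁻¹) * (1 + b)⁻¹) ^ (p + 2)) := by
        gcongr
        · exact inv_le_mul_inv_one_add hε ha
        · exact inv_le_mul_inv_one_add hε hb
    _ = _ := by rw [mul_pow _ (1 + a)⁻¹, mul_pow _ (1 + b)⁻¹]; ring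

theorem integrable_inv_one_add_norm_pow {E : Type*} [NormedAddCommGroup E] [NormedSpace ℝ E]
    [FiniteDimensional ℝ E] [MeasurableSpace E] [BorelSpace E] (μ : Measure E)
    [μ.IsAddHaarMeasure] {k : ℕ} (hk : Module.finrank ℝ E < k) :
    Integrable (fun y : E => ((1 + ‖y‖)⁻¹) ^ k) μ := by
  refine (integrable_one_add_norm (μ := μ) (r := k) (mod_cast hk)).congr (.of_forall fun y => ?_)
  simp only [Real.rpow_neg (by positivity : 0 ≤ 1 + ‖y‖), Real.rpow_natCast, inv_pow]

/-- The convolution-type integral over the part of space away from `x` and, at scale `‖x‖`, away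
from the origin. -/
theorem setIntegral_inv_pow_mul_inv_pow_le {E : Type*} [NormedAddCommGroup E] [NormedSpace ℝ E]
    [FiniteDimensional ℝ E] [MeasurableSpace E] [BorelSpace E] (μ : Measure E)
    [μ.IsAddHaarMeasure] {p : ℕ} (hp : Module.finrank ℝ E < p + 2) {ε : ℝ} (hε : 0 < ε)
    (hε1 : ε ≤ 1) {x : E} (hx : 1 ≤ ‖x‖) :
    ∫ y in {y : E | 1 ≤ ‖x - y‖ ∧ ε * ‖x‖ ≤ ‖y‖}, (‖x - y‖ ^ p)⁻¹ * (‖y‖ ^ (p + 2))⁻¹ ∂μ ≤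
      ((ε * ‖x‖) ^ p)⁻¹ * (1 + ε⁻¹) ^ (p + 2) *
        (2 * ∫ y, ((1 + ‖y‖)⁻¹) ^ (p + 2) ∂μ) := by
  have hg := integrable_inv_one_add_norm_pow μ hp
  have hgx : Integrable (fun y : E => ((1 + ‖x - y‖)⁻¹) ^ (p + 2)) μ := hg.comp_sub_left x
  have hG := (hgx.add hg).const_mul (((ε * ‖x‖) ^ p)⁻¹ * (1 + ε⁻¹) ^ (p + 2))
  have hmeas : MeasurableSet {y : E | 1 ≤ ‖x - y‖ ∧ ε * ‖x‖ ≤ ‖y‖} := by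
    measurability
  calc _ ≤ ∫ y in {y : E | 1 ≤ ‖x - y‖ ∧ ε * ‖x‖ ≤ ‖y‖},
        ((ε * ‖x‖) ^ p)⁻¹ * (1 + ε⁻¹) ^ (p + 2) *
          (((1 + ‖x - y‖)⁻¹) ^ (p + 2) + ((1 + ‖y‖)⁻¹) ^ (p + 2)) ∂μ := by
        refine integral_mono_of_nonneg (.of_forall fun y => by positivity) hG.integrableOn ?_
        filter_upwards [ae_restrict_mem hmeas] with y ⟨hxy, hy⟩
        exact inv_pow_mul_inv_pow_le hε (by linarith) (hε1.trans hxy)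
          ((le_mul_of_one_le_right hε.le hx).trans hy) hy p
    _ ≤ ∫ y, ((ε * ‖x‖) ^ p)⁻¹ * (1 + ε⁻¹) ^ (p + 2) *
          (((1 + ‖x - y‖)⁻¹) ^ (p + 2) + ((1 + ‖y‖)⁻¹) ^ (p + 2)) ∂μ :=
        setIntegral_le_integral hG (.of_forall fun y => by positivity)
    _ = _ := by
        rw [integral_const_mul, integral_add hgx hg,
          integral_sub_left_eq_self (fun y : E => ((1 + ‖y‖)⁻¹) ^ (p + 2)) μ x, two_mul]

/-- In dimensions `d = 3, 4`: the square root of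
`∫_{|x-y| ≥ 1, |y| ≥ ε|x|} |x-y|^{-2(d-2)} |y|^{-2(d-1)} dy` is `O(|x|^{-(d-2)})`,
uniformly for `|x| ≥ 1`. -/
theorem integral_bound_dim_three_four
    (d : ℕ) (hd : d = 3 ∨ d = 4) (ε : ℝ) (hε : ε ∈ Set.Ioo (0 : ℝ) 1) :
    ∃ C : ℝ, ∀ x : EuclideanSpace ℝ (Fin d), 1 ≤ ‖x‖ →
      Real.sqrt
          (∫ y in {y : EuclideanSpace ℝ (Fin d) | 1 ≤ ‖x - y‖ ∧ ε * ‖x‖ ≤ ‖y‖},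
            (‖x - y‖ ^ (2 * (d - 2)))⁻¹ * (‖y‖ ^ (2 * (d - 1)))⁻¹) ≤
        C * (‖x‖ ^ (d - 2))⁻¹ := by
  obtain ⟨hε0, hε1⟩ := hε
  have hexp : 2 * (d - 1) = 2 * (d - 2) + 2 := by omega
  have hfin : Module.finrank ℝ (EuclideanSpace ℝ (Fin d)) < 2 * (d - 2) + 2 := by
    rw [finrank_euclideanSpace_fin]; omega
  set A : ℝ := (ε ^ (2 * (d - 2)))⁻¹ * (1 + ε⁻¹) ^ (2 * (d - 2) + 2) *
    (2 * ∫ y : EuclideanSpace ℝ (Fin d), ((1 + ‖y‖)⁻¹) ^ (2 * (d - 2) + 2)) with hA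
  refine ⟨√A, fun x hx => ?_⟩
  rw [hexp]
  calc _ ≤ √(A * ((‖x‖ ^ (d - 2))⁻¹) ^ 2) := by
        refine Real.sqrt_le_sqrt
          ((setIntegral_inv_pow_mul_inv_pow_le volume hfin hε0 hε1.le hx).trans_eq ?_)
        rw [hA, mul_pow, mul_inv, inv_pow, ← pow_mul, mul_comm (d - 2) 2]
        ring
    _ = √A * (‖x‖ ^ (d - 2))⁻¹ := by
        rw [Real.sqrt_mul' _ (by positivity), Real.sqrt_sq (by positivity)]

end
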